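/- If G is a k-tree on n vertices with maximum spectral radius among all k-trees on n vertices, then G is isomorphic to S_{k,n−k}. -/

import Mathlib

open Matrix SimpleGraph

attribute [local instance] Classical.propDecidable

/-- The spectral radius of a finite simple graph: the largest eigenvalue of its
adjacency matrix (as the supremum of its real spectrum). -/
noncomputable def specRad {V : Type*} [Fintype V] [DecidableEq V] (G : SimpleGraph V) : ℝ :=
  sSup (spectrum ℝ (G.adjMatrix ℝ))

/-- `G` is a `k`-tree: there is a construction ordering of the vertices such that the
first `k` vertices form a clique (this is `K_k`, when the graph has exactly `k` vertices),
and every later vertex is adjacent, among the earlier vertices, to exactly a clique of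
size `k`.  This is the usual inductive definition of a `k`-tree, phrased via a
construction order. -/
def IsKTree (k : ℕ) {V : Type*} [Fintype V] (G : SimpleGraph V) : Prop :=
  k ≤ Fintype.card V ∧
  ∃ e : Fin (Fintype.card V) ≃ V,
    (∀ i j : Fin (Fintype.card V), (i : ℕ) < k → (j : ℕ) < k → i ≠ j → G.Adj (e i) (e j)) ∧
    (∀ i : Fin (Fintype.card V), k ≤ (i : ℕ) →
      ∃ s : Finset (Fin (Fintype.card V)),
        s.card = k ∧ (∀ j ∈ s, (j : ℕ) < (i : ℕ)) ∧
        (∀ j₁ ∈ s, ∀ j₂ ∈ s, j₁ ≠ j₂ → G.Adj (e j₁) (e j₂)) ∧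
        (∀ j : Fin (Fintype.card V), (j : ℕ) < (i : ℕ) → (G.Adj (e i) (e j) ↔ j ∈ s)))

/-- The complete split graph `S_{k,m}`: a clique on `k` vertices completely joined to an
independent set on `m` vertices. -/
def completeSplitGraph (k m : ℕ) : SimpleGraph (Fin k ⊕ Fin m) :=
  SimpleGraph.fromRel (fun a _ => a.isLeft = true)

namespace KTreeSpectral

section Spectrum

variable {V : Type*} [Fintype V] [DecidableEq V]

lemma mem_spectrum_of_mulVec_eq {A : Matrix V V ℝ} {x : V → ℝ} {μ : ℝ} (hx : x ≠ 0)
    (h : A *ᵥ x = μ • x) : μ ∈ spectrum ℝ A := by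
  rw [← Matrix.spectrum_toLin']
  exact (Module.End.hasEigenvalue_of_hasEigenvector
    ⟨Module.End.mem_eigenspace_iff.2 (by simpa using h), hx⟩).mem_spectrum

lemma le_sSup_spectrum {A : Matrix V V ℝ} {x : V → ℝ} {μ : ℝ} (hx : x ≠ 0)
    (h : A *ᵥ x = μ • x) : μ ≤ sSup (spectrum ℝ A) :=
  le_csSup A.finite_real_spectrum.bddAbove (mem_spectrum_of_mulVec_eq hx h)

lemma posSemidef_sSup_spectrum_smul_sub {A : Matrix V V ℝ} (hA : A.IsHermitian) :
    (sSup (spectrum ℝ A) • (1 : Matrix V V ℝ) - A).PosSemidef := by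
  rw [Matrix.posSemidef_iff_isHermitian_and_spectrum_nonneg]
  refine ⟨.sub (by simp [Matrix.IsHermitian]) hA, fun r hr => ?_⟩
  rw [← Algebra.algebraMap_eq_smul_one, ← spectrum.singleton_sub_eq] at hr
  obtain ⟨_, rfl, b, hb, rfl⟩ := hr
  simpa using le_csSup A.finite_real_spectrum.bddAbove hb

/-- A weak form of the Perron–Frobenius theorem for symmetric matrices. -/
lemma exists_nonneg_eigenvector [Nonempty V] {A : Matrix V V ℝ} (hA : A.IsHermitian)
    (h0 : ∀ i j, 0 ≤ A i j) :
    ∃ x : V → ℝ, (∀ v, 0 ≤ x v) ∧ x ≠ 0 ∧ A *ᵥ x = sSup (spectrum ℝ A) • x := by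
  have hne : (spectrum ℝ A).Nonempty := by
    rw [hA.spectrum_real_eq_range_eigenvalues]
    exact Set.range_nonempty _
  have hmem := hne.csSup_mem A.finite_real_spectrum
  have hpsd := posSemidef_sSup_spectrum_smul_sub hA
  set μ := sSup (spectrum ℝ A)
  rw [← Matrix.spectrum_toLin'] at hmem
  obtain ⟨y, hy⟩ := (Module.End.HasEigenvalue.of_mem_spectrum hmem).exists_hasEigenvector
  have hAy : A *ᵥ y = μ • y := by simpa using hy.apply_eq_smul
  refine ⟨fun v => |y v|, fun v => abs_nonneg _, fun h => hy.2 ?_, ?_⟩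
  · ext v
    simpa using congrFun h v
  · have hle : y ⬝ᵥ A *ᵥ y ≤ (fun v => |y v|) ⬝ᵥ A *ᵥ (fun v => |y v|) := by
      simp only [dotProduct, mulVec, Finset.mul_sum]
      refine Finset.sum_le_sum fun i _ => Finset.sum_le_sum fun j _ => ?_
      calc y i * (A i j * y j) ≤ |y i * (A i j * y j)| := le_abs_self _
        _ = |y i| * (A i j * |y j|) := by rw [abs_mul, abs_mul, abs_of_nonneg (h0 i j)]
    have hsq : (fun v => |y v|) ⬝ᵥ (fun v => |y v|) = y ⬝ᵥ y := by
      simp [dotProduct]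
    have hnn := hpsd.dotProduct_mulVec_nonneg (fun v => |y v|)
    have hz := (hpsd.dotProduct_mulVec_zero_iff (fun v => |y v|)).1 (by
      refine le_antisymm ?_ hnn
      simp only [star_trivial, Matrix.sub_mulVec, Matrix.smul_mulVec, Matrix.one_mulVec,
        dotProduct_sub, dotProduct_smul, hsq]
      rw [hAy, dotProduct_smul] at hle
      linarith)
    rw [Matrix.sub_mulVec, Matrix.smul_mulVec, Matrix.one_mulVec, sub_eq_zero] at hz
    exact hz.symm

/-- The extremal case of the row-sum argument bounding the spectral radius in terms of the
minimum row sum and the total sum. -/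
lemma rowSum_eq_of_extremal {A : Matrix V V ℝ} (hs : A.IsSymm)
    (h1 : ∀ i j, A i j ≤ 1) (hdiag : ∀ i, A i i = 0) {x : V → ℝ} (hx : ∀ v, 0 < x v) {μ k : ℝ}
    (hAx : A *ᵥ x = μ • x) (hd : ∀ v, k ≤ ∑ u, A v u)
    (hm : ∑ v, ∑ u, A v u ≤ k * (k - 1) + 2 * k * (Fintype.card V - k))
    (hμ : k * (Fintype.card V - k) ≤ μ ^ 2 - (k - 1) * μ) (v : V) :
    ∑ v, ∑ u, A v u = k * (k - 1) + 2 * k * (Fintype.card V - k) ∧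
      ∀ u, u ≠ v → A v u = 0 → ∑ w, A u w = k := by
  set d : V → ℝ := fun v => ∑ u, A v u with hd_def
  set M : ℝ := k * (k - 1) + 2 * k * (Fintype.card V - k) with hM
  have hadj : ∀ f : V → ℝ, ∑ v, x v * ∑ u, A v u * f u = μ * ∑ u, x u * f u := by
    intro f
    simp only [Finset.mul_sum]
    rw [Finset.sum_comm]
    refine Finset.sum_congr rfl fun u _ => ?_
    have := congrFun hAx u
    simp only [mulVec, dotProduct, Pi.smul_apply, smul_eq_mul] at this
    rw [← mul_assoc, ← this, Finset.sum_mul]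
    refine Finset.sum_congr rfl fun w _ => ?_
    rw [← hs.apply w u]
    ring
  have hone : ∑ v, x v * d v = μ * ∑ u, x u := by simpa [d] using hadj fun _ => 1
  have htwo : ∑ v, x v * ∑ u, A v u * d u = μ ^ 2 * ∑ u, x u := by
    rw [hadj, hone]
    ring
  set T : V → ℝ := fun v => ∑ u, (1 - A v u - if u = v then 1 else 0) * (d u - k) with hT_def
  have hcoef : ∀ v u, 0 ≤ 1 - A v u - if u = v then 1 else 0 := by
    intro v u
    split_ifs with h
    · simp [h, hdiag]
    · simpa using h1 v u
  have hTterm : ∀ v u, 0 ≤ (1 - A v u - if u = v then 1 else 0) * (d u - k) := fun v u =>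
    mul_nonneg (hcoef v u) (sub_nonneg.2 (hd u))
  have hT0 : ∀ v, 0 ≤ T v := fun v => Finset.sum_nonneg fun u _ => hTterm v u
  have hT : ∀ v, T v = ∑ u, d u - Fintype.card V * k - ∑ u, A v u * d u + k * d v - d v + k := by
    intro v
    simp only [T, sub_mul, mul_sub, one_mul, ite_mul, zero_mul, Finset.sum_sub_distrib,
      Finset.sum_ite_eq', Finset.mem_univ, if_true, Finset.sum_const, Finset.card_univ,
      nsmul_eq_mul, ← Finset.sum_mul]
    change _ = _ + k * (∑ u, A v u) - _ + _
    ring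
  have hterm : ∀ v, 0 ≤ x v * (T v + (M - ∑ u, d u)) := fun v =>
    mul_nonneg (hx v).le (add_nonneg (hT0 v) (sub_nonneg.2 hm))
  have hsum : ∑ v, x v * (T v + (M - ∑ u, d u)) =
      (k * (Fintype.card V - k) - (μ ^ 2 - (k - 1) * μ)) * ∑ u, x u := by
    have : ∀ v, x v * (T v + (M - ∑ u, d u)) = (k * (Fintype.card V - k)) * x v
        - x v * ∑ u, A v u * d u + (k - 1) * (x v * d v) := by
      intro v
      rw [hT, hM]
      ring
    simp only [this, Finset.sum_add_distrib, Finset.sum_sub_distrib, ← Finset.mul_sum]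
    rw [hone, htwo]
    ring
  have hzero : ∑ v, x v * (T v + (M - ∑ u, d u)) = 0 := by
    refine le_antisymm ?_ (Finset.sum_nonneg fun v _ => hterm v)
    rw [hsum]
    exact mul_nonpos_of_nonpos_of_nonneg (by linarith) (Finset.sum_nonneg fun v _ => (hx v).le)
  have hv := (Finset.sum_eq_zero_iff_of_nonneg fun v _ => hterm v).1 hzero v (Finset.mem_univ v)
  have hv' := (mul_eq_zero.1 hv).resolve_left (hx v).ne'
  have hTv := hT0 v
  refine ⟨by linarith, fun u huv hu => ?_⟩
  have hTz : T v = 0 := by linarith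
  have := (Finset.sum_eq_zero_iff_of_nonneg fun u _ => hTterm v u).1 hTz u (Finset.mem_univ u)
  rw [hu, if_neg huv] at this
  change d u = k
  linarith

lemma nonempty_iso_completeSplitGraph {G : SimpleGraph V} {k n : ℕ} (hn : Fintype.card V = n)
    (D : Finset V) (hD : D.card = k) (hadj : ∀ u v, G.Adj u v ↔ u ≠ v ∧ (u ∈ D ∨ v ∈ D)) :
    Nonempty (G ≃g completeSplitGraph k (n - k)) := by
  have e₁ : {v // v ∈ D} ≃ Fin k := Fintype.equivFinOfCardEq (by simpa using hD)
  have e₂ : {v // ¬ v ∈ D} ≃ Fin (n - k) := Fintype.equivFinOfCardEq (by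
    rw [Fintype.card_subtype_compl, Fintype.card_coe, hn, hD])
  let φ : Fin k ⊕ Fin (n - k) ≃ V :=
    (Equiv.sumCongr e₁.symm e₂.symm).trans (Equiv.sumCompl (· ∈ D))
  have hφ : ∀ a, φ a ∈ D ↔ a.isLeft = true := by
    rintro (a | a)
    · simp [φ]
    · simpa [φ] using (e₂.symm a).2
  refine ⟨RelIso.symm ⟨φ, fun {a b} => ?_⟩⟩
  rw [hadj, hφ, hφ, completeSplitGraph, SimpleGraph.fromRel_adj, φ.injective.ne_iff]

end Spectrum

/-- The complete split graph, realised on an initial segment of the naturals. -/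
def finSplitGraph (k n : ℕ) : SimpleGraph (Fin n) where
  Adj i j := i ≠ j ∧ ((i : ℕ) < k ∨ (j : ℕ) < k)
  symm := ⟨fun _ _ h => ⟨h.1.symm, h.2.symm⟩⟩
  loopless := ⟨fun _ h => h.1 rfl⟩

lemma isKTree_finSplitGraph {k n : ℕ} (hkn : k ≤ n) : IsKTree k (finSplitGraph k n) := by
  refine ⟨by simpa using hkn, finCongr (Fintype.card_fin n), ?_, ?_⟩
  · intro i j hi hj hij
    exact ⟨(finCongr (Fintype.card_fin n)).injective.ne hij, Or.inl (by simpa using hi)⟩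
  · intro i hi
    refine ⟨Finset.univ.filter fun j => (j : ℕ) < k, ?_, ?_, ?_, ?_⟩
    · rw [← Fintype.card_subtype]
      refine (Fintype.card_congr ⟨fun j => ⟨j.1, j.2⟩,
        fun j : Fin k => ⟨⟨j, by simp; omega⟩, j.2⟩, fun _ => rfl, fun _ => rfl⟩).trans
        (Fintype.card_fin k)
    · intro j hj
      exact (Finset.mem_filter.1 hj).2.trans_le hi
    · intro j₁ hj₁ j₂ hj₂ h
      exact ⟨(finCongr (Fintype.card_fin n)).injective.ne h,
        Or.inl (by simpa using hj₁)⟩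
    · intro j hj
      have : i ≠ j := by rintro rfl; omega
      simp [finSplitGraph, this, hi.not_gt]

lemma sum_ite_val_lt {k n : ℕ} (hkn : k ≤ n) (a b : ℝ) :
    ∑ i : Fin n, (if (i : ℕ) < k then a else b) = k * a + (n - k) * b := by
  rw [Fin.sum_univ_eq_sum_range (fun i => if i < k then a else b) n]
  obtain ⟨m, rfl⟩ := Nat.exists_eq_add_of_le hkn
  rw [Finset.sum_range_add, Finset.sum_congr rfl fun i hi => if_pos (Finset.mem_range.1 hi)]
  simp

lemma le_specRad_finSplitGraph {k n : ℕ} (hk : 1 ≤ k) (hkn : k < n) {t : ℝ} (ht : 0 < t)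
    (h : t ^ 2 - (k - 1) * t = k * (n - k)) : t ≤ specRad (finSplitGraph k n) := by
  let x : Fin n → ℝ := fun i => if (i : ℕ) < k then t else k
  refine le_sSup_spectrum (x := x) (fun hx => ?_) ?_
  · have : t = 0 := by simpa [x, show 0 < k by omega] using congrFun hx ⟨0, by omega⟩
    exact ht.ne' this
  · ext i
    have hentry : ∀ j, (finSplitGraph k n).adjMatrix ℝ i j * x j =
        (if (j : ℕ) < k then t else if (i : ℕ) < k then (k : ℝ) else 0) -
          if j = i then (if (i : ℕ) < k then t else 0) else 0 := by
      intro j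
      rw [SimpleGraph.adjMatrix_apply]
      by_cases hij : j = i
      · subst hij
        simp only [finSplitGraph, x]
        split_ifs <;> simp_all
      · have := Ne.symm hij
        by_cases hi : (i : ℕ) < k <;> by_cases hj : (j : ℕ) < k <;>
          simp [finSplitGraph, x, hi, hj, hij, this]
    simp only [mulVec, dotProduct, hentry, Finset.sum_sub_distrib, sum_ite_val_lt hkn.le,
      Finset.sum_ite_eq', Finset.mem_univ, if_true, Pi.smul_apply, smul_eq_mul, x]
    split_ifs
    · linarith
    · ring

variable {V : Type*} [Fintype V] {G : SimpleGraph V} {k : ℕ}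

lemma _root_.IsKTree.le_degree (h : IsKTree k G) (hk : k < Fintype.card V) (v : V) :
    k ≤ G.degree v := by
  obtain ⟨-, e, hbase, hstep⟩ := h
  suffices ∃ s : Finset (Fin (Fintype.card V)), s.card = k ∧ ∀ j ∈ s, G.Adj v (e j) by
    obtain ⟨s, hs, hadj⟩ := this
    rw [← hs, ← Finset.card_map e.toEmbedding, ← G.card_neighborFinset_eq_degree]
    refine Finset.card_le_card fun w hw => ?_
    obtain ⟨j, hj, rfl⟩ := Finset.mem_map.1 hw
    simpa using hadj j hj
  obtain ⟨i, rfl⟩ := e.surjective v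
  rcases lt_or_ge (i : ℕ) k with hi | hi
  · let p : Fin (Fintype.card V) := ⟨k, hk⟩
    obtain ⟨s, hs, hlt, -, hadj⟩ := hstep p le_rfl
    have hsub : s ⊆ Finset.Iio p := fun j hj => Finset.mem_Iio.2 (hlt j hj)
    have hsI : s = Finset.Iio p := Finset.eq_of_subset_of_card_le hsub (by simp [p, hs])
    have his : i ∈ s := hsI ▸ Finset.mem_Iio.2 hi
    have hps : p ∉ s.erase i := fun hp => (hlt p (Finset.mem_of_mem_erase hp)).false
    refine ⟨insert p (s.erase i), ?_, fun j hj => ?_⟩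
    · rw [Finset.card_insert_of_notMem hps, Finset.card_erase_add_one his, hs]
    · rcases Finset.mem_insert.1 hj with rfl | hj
      · exact ((hadj i hi).2 his).symm
      · exact hbase i j hi (hlt j (Finset.mem_of_mem_erase hj)) (Finset.ne_of_mem_erase hj).symm
  · obtain ⟨s, hs, hlt, -, hadj⟩ := hstep i hi
    exact ⟨s, hs, fun j hj => (hadj j (hlt j hj)).2 hj⟩

lemma two_mul_sum_min {n : ℕ} (hkn : k ≤ n) :
    2 * ∑ i : Fin n, ((min (i : ℕ) k : ℕ) : ℝ) = k * (k - 1) + 2 * k * (n - k) := by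
  rw [Fin.sum_univ_eq_sum_range (fun i => ((min i k : ℕ) : ℝ)) n]
  induction n, hkn using Nat.le_induction with
  | base =>
    have : ∀ m : ℕ, 2 * ∑ i ∈ Finset.range m, (i : ℝ) = m * (m - 1) := by
      intro m
      induction m with
      | zero => simp
      | succ m ih => rw [Finset.sum_range_succ, mul_add, ih]; push_cast; ring
    rw [Finset.sum_congr rfl fun i hi => by rw [min_eq_left (Finset.mem_range.1 hi).le], this]
    ring
  | succ n hn ih =>
    rw [Finset.sum_range_succ, mul_add, ih, min_eq_right hn]
    push_cast
    ring

lemma _root_.IsKTree.sum_adjMatrix_le (h : IsKTree k G) :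
    ∑ v, ∑ u, G.adjMatrix ℝ v u ≤ k * (k - 1) + 2 * k * (Fintype.card V - k) := by
  obtain ⟨hkn, e, -, hstep⟩ := h
  let B : Fin (Fintype.card V) → Fin (Fintype.card V) → ℝ := fun i j =>
    if j < i then G.adjMatrix ℝ (e i) (e j) else 0
  have hsplit : ∀ i j, G.adjMatrix ℝ (e i) (e j) = B i j + B j i := by
    intro i j
    rcases lt_trichotomy i j with hij | rfl | hij
    · simp [B, hij, hij.not_gt, G.adj_comm]
    · simp [B]
    · simp [B, hij, hij.not_gt]
  have hB : ∀ i, ∑ j, B i j ≤ ((min (i : ℕ) k : ℕ) : ℝ) := by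
    intro i
    suffices ∃ s : Finset (Fin (Fintype.card V)), s.card = min (i : ℕ) k ∧
        ∀ j, j < i → G.Adj (e i) (e j) → j ∈ s by
      obtain ⟨s, hs, hadj⟩ := this
      calc ∑ j, B i j ≤ ∑ j, if j ∈ s then (1 : ℝ) else 0 := by
            refine Finset.sum_le_sum fun j _ => ?_
            simp only [B, SimpleGraph.adjMatrix_apply]
            have := hadj j
            split_ifs <;> simp_all
        _ = _ := by simp [hs]
    rcases lt_or_ge (i : ℕ) k with hi | hi
    · exact ⟨Finset.Iio i, by simp [hi.le], fun j hj _ => Finset.mem_Iio.2 hj⟩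
    · obtain ⟨s, hs, -, -, hadj⟩ := hstep i hi
      exact ⟨s, by simp [hs, hi], fun j hj => (hadj j hj).1⟩
  calc ∑ v, ∑ u, G.adjMatrix ℝ v u = ∑ i, ∑ j, G.adjMatrix ℝ (e i) (e j) := by
        rw [← e.sum_comp]
        exact Finset.sum_congr rfl fun i _ => (e.sum_comp _).symm
    _ = 2 * ∑ i, ∑ j, B i j := by
        simp only [hsplit, Finset.sum_add_distrib]
        rw [Finset.sum_comm (f := fun i j => B j i)]
        ring
    _ ≤ 2 * ∑ i : Fin (Fintype.card V), ((min (i : ℕ) k : ℕ) : ℝ) := by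
        gcongr with i
        exact hB i
    _ = _ := two_mul_sum_min hkn

lemma _root_.IsKTree.eigenvector_pos (h : IsKTree k G) (hk : 1 ≤ k) {x : V → ℝ} {μ : ℝ}
    (hx0 : ∀ v, 0 ≤ x v) (hx : x ≠ 0) (hAx : G.adjMatrix ℝ *ᵥ x = μ • x) (v : V) : 0 < x v := by
  have hprop : ∀ {u w}, G.Adj u w → x u = 0 → x w = 0 := by
    intro u w huw hu
    have := congrFun hAx u
    rw [SimpleGraph.adjMatrix_mulVec_apply, Pi.smul_apply, hu, smul_zero,
      Finset.sum_eq_zero_iff_of_nonneg fun w _ => hx0 w] at this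
    exact this w (by simpa using huw)
  obtain ⟨hkn, e, hbase, hstep⟩ := h
  let o : Fin (Fintype.card V) := ⟨0, by omega⟩
  have hroot : ∀ m (i : Fin (Fintype.card V)), (i : ℕ) = m → (x (e i) = 0 ↔ x (e o) = 0) := by
    intro m
    induction m using Nat.strong_induction_on with
    | _ m ih =>
      rintro i rfl
      rcases lt_or_ge (i : ℕ) k with hi | hi
      · by_cases hio : i = o
        · rw [hio]
        · have := hbase i o hi hk hio
          exact ⟨hprop this, hprop this.symm⟩
      · obtain ⟨s, hs, hlt, -, hadj⟩ := hstep i hi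
        obtain ⟨j, hj⟩ := Finset.card_pos.1 (hs ▸ hk)
        have := (hadj j (hlt j hj)).2 hj
        rw [← ih j (hlt j hj) j rfl]
        exact ⟨hprop this, hprop this.symm⟩
  refine (hx0 v).lt_of_ne' fun hv => hx ?_
  obtain ⟨i, rfl⟩ := e.surjective v
  ext w
  obtain ⟨j, rfl⟩ := e.surjective w
  exact (hroot _ j rfl).2 ((hroot _ i rfl).1 hv)

lemma exists_quadratic_root {k n : ℝ} (hk : 0 < k) (hkn : k < n) :
    ∃ t, 0 < t ∧ k - 1 ≤ t ∧ t ^ 2 - (k - 1) * t = k * (n - k) := by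
  have hnn : 0 ≤ k * (n - k) := mul_nonneg hk.le (sub_nonneg.2 hkn.le)
  have hsq := Real.sq_sqrt (add_nonneg (sq_nonneg (k - 1)) (mul_nonneg zero_le_four hnn))
  have hge : |k - 1| ≤ √((k - 1) ^ 2 + 4 * (k * (n - k))) :=
    Real.abs_le_sqrt (by linarith)
  refine ⟨(k - 1 + √((k - 1) ^ 2 + 4 * (k * (n - k)))) / 2, ?_, ?_, by nlinarith⟩
  · have := neg_abs_le (k - 1)
    have : |k - 1| < √((k - 1) ^ 2 + 4 * (k * (n - k))) :=
      Real.lt_sqrt_of_sq_lt (by rw [sq_abs]; nlinarith [mul_pos hk (sub_pos.2 hkn)])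
    linarith
  · have := le_abs_self (k - 1)
    linarith

lemma _root_.IsKTree.exists_iso_of_degree [DecidableEq V] (h : IsKTree k G) (hk : k < Fintype.card V)
    (hsum : ∑ v, (G.degree v : ℝ) = k * (k - 1) + 2 * k * (Fintype.card V - k))
    (hdeg : ∀ v u, u ≠ v → ¬ G.Adj v u → G.degree u = k) :
    Nonempty (G ≃g completeSplitGraph k (Fintype.card V - k)) := by
  rcases (Nat.succ_le_of_lt hk).eq_or_lt with hcard | hcard
  · obtain ⟨D, hD⟩ := Finset.exists_subset_card_eq (s := (Finset.univ : Finset V)) (n := k) hk.le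
    have hcompl : Dᶜ.card = 1 := by rw [Finset.card_compl, hD.2]; omega
    refine nonempty_iso_completeSplitGraph rfl D hD.2 fun u v => ⟨fun huv => ⟨huv.ne, ?_⟩, ?_⟩
    · by_contra! hc
      exact huv.ne (Finset.card_le_one.1 hcompl.le u (by simpa using hc.1) v (by simpa using hc.2))
    · rintro ⟨huv, -⟩
      have hu : G.degree u = Fintype.card V - 1 := by
        have := h.le_degree hk u
        have := G.degree_lt_card_verts u
        omega
      have hN : G.neighborFinset u = Finset.univ.erase u := by
        refine Finset.eq_of_subset_of_card_le (fun w hw => ?_) ?_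
        · simpa using (G.ne_of_adj ((G.mem_neighborFinset u w).1 hw)).symm
        · simp [hu]
      rw [← G.mem_neighborFinset, hN]
      simpa using huv.symm
  · let D : Finset V := Finset.univ.filter fun v => ∀ u, u ≠ v → G.Adj v u
    have hDdeg : ∀ v ∈ D, G.degree v = Fintype.card V - 1 := by
      intro v hv
      have : G.neighborFinset v = Finset.univ.erase v := by
        ext u
        have := (Finset.mem_filter.1 hv).2 u
        simpa using ⟨fun h => h.ne', this⟩
      rw [← G.card_neighborFinset_eq_degree, this]
      simp
    have hDcdeg : ∀ v ∉ D, G.degree v = k := by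
      intro v hv
      simp only [D, Finset.mem_filter, Finset.mem_univ, true_and, not_forall] at hv
      obtain ⟨u, huv, hadj⟩ := hv
      exact hdeg u v huv.symm fun h => hadj h.symm
    have hD : D.card = k := by
      have hdegR : ∀ v, (G.degree v : ℝ) = k +
          if v ∈ D then (Fintype.card V - 1 - k : ℝ) else 0 := by
        intro v
        split_ifs with hv
        · rw [hDdeg v hv, Nat.cast_sub (by omega)]; push_cast; ring
        · rw [hDcdeg v hv, add_zero]
      simp only [hdegR, Finset.sum_add_distrib, Finset.sum_const, Finset.card_univ, nsmul_eq_mul,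
        Finset.sum_ite_mem, Finset.univ_inter] at hsum
      have hpos : (0 : ℝ) < Fintype.card V - 1 - k := by
        have : ((k + 1 : ℕ) : ℝ) < Fintype.card V := Nat.cast_lt.2 hcard
        push_cast at this
        linarith
      have : (D.card - k : ℝ) * (Fintype.card V - 1 - k) = 0 := by linarith
      exact_mod_cast sub_eq_zero.1 ((mul_eq_zero.1 this).resolve_right hpos.ne')
    have hDadj : ∀ {u v}, u ∈ D → v ≠ u → G.Adj u v := fun {u v} hu =>
      (Finset.mem_filter.1 hu).2 v
    refine nonempty_iso_completeSplitGraph rfl D hD fun u v => ⟨fun huv => ⟨huv.ne, ?_⟩, ?_⟩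
    · by_contra! hc
      have hsub : D ⊆ G.neighborFinset u := fun w hw =>
        (G.mem_neighborFinset u w).2 (hDadj hw fun huw => hc.1 (by rwa [huw])).symm
      have heq := Finset.eq_of_subset_of_card_le hsub (by
        rw [G.card_neighborFinset_eq_degree, hDcdeg u hc.1, hD])
      exact hc.2 (heq ▸ (G.mem_neighborFinset u v).2 huv)
    · rintro ⟨huv, hu | hv⟩
      · exact hDadj hu huv.symm
      · exact (hDadj hv huv).symm

end KTreeSpectral

theorem stmt6 {V : Type*} [Fintype V] [DecidableEq V] (G : SimpleGraph V) (k n : ℕ)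
    (hn : Fintype.card V = n) (hG : IsKTree k G)
    -- `G` has the maximum spectral radius among all `k`-trees on `n` vertices
    (hmax : ∀ H : SimpleGraph (Fin n), IsKTree k H → specRad H ≤ specRad G) :
    Nonempty (G ≃g completeSplitGraph k (n - k)) := by
  subst hn
  rcases hG.1.eq_or_lt with hk | hk
  · obtain ⟨-, e, hbase, -⟩ := hG
    refine KTreeSpectral.nonempty_iso_completeSplitGraph rfl Finset.univ (by simp [hk])
      fun u v => ⟨fun h => ⟨h.ne, by simp⟩, fun h => ?_⟩
    simpa using hbase (e.symm u) (e.symm v) (by omega) (by omega) (e.symm.injective.ne h.1)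
  have : Nonempty V := Fintype.card_pos_iff.1 (by omega)
  rcases Nat.eq_zero_or_pos k with rfl | hk0
  · obtain ⟨-, e, -, hstep⟩ := hG
    have hearlier : ∀ i j : Fin (Fintype.card V), j < i → ¬ G.Adj (e i) (e j) := by
      intro i j hji hadj
      obtain ⟨s, hs, -, -, hiff⟩ := hstep i (Nat.zero_le _)
      rw [Finset.card_eq_zero] at hs
      simpa [hs] using (hiff j hji).1 hadj
    refine KTreeSpectral.nonempty_iso_completeSplitGraph rfl ∅ rfl
      fun u v => ⟨fun h => ?_, by simp⟩
    obtain ⟨i, rfl⟩ := e.surjective u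
    obtain ⟨j, rfl⟩ := e.surjective v
    rcases lt_trichotomy i j with hij | rfl | hij
    · exact (hearlier j i hij h.symm).elim
    · exact (G.loopless.irrefl _ h).elim
    · exact (hearlier i j hij h).elim
  have hkR : (0 : ℝ) < k := Nat.cast_pos.2 hk0
  obtain ⟨t, ht0, hkt, ht⟩ := KTreeSpectral.exists_quadratic_root hkR
    (Nat.cast_lt.2 hk : (k : ℝ) < Fintype.card V)
  have htμ : t ≤ specRad G := (KTreeSpectral.le_specRad_finSplitGraph hk0 hk ht0 ht).trans
    (hmax _ (KTreeSpectral.isKTree_finSplitGraph hk.le))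
  have hherm : (G.adjMatrix ℝ).IsHermitian := by
    simp [Matrix.IsHermitian]
  obtain ⟨x, hx0, hx, hAx⟩ := KTreeSpectral.exists_nonneg_eigenvector hherm fun i j => by
    rw [SimpleGraph.adjMatrix_apply]
    split_ifs <;> simp
  have hrow : ∀ v, ∑ u, G.adjMatrix ℝ v u = G.degree v := fun v => by
    simpa only [mulVec, dotProduct, Function.const_apply, mul_one] using
      G.adjMatrix_mulVec_const_apply (a := (1 : ℝ)) (v := v)
  have key := KTreeSpectral.rowSum_eq_of_extremal G.isSymm_adjMatrix
    (fun i j => by rw [SimpleGraph.adjMatrix_apply]; split_ifs <;> simp) (by simp)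
    (hG.eigenvector_pos hk0 hx0 hx hAx) hAx
    (fun v => by
      rw [hrow]
      exact_mod_cast hG.le_degree hk v)
    hG.sum_adjMatrix_le (by
      change _ ≤ specRad G ^ 2 - (k - 1) * specRad G
      nlinarith)
  simp only [hrow] at key
  refine hG.exists_iso_of_degree hk (key (Classical.arbitrary V)).1
    fun v u huv hadj => ?_
  exact_mod_cast (key v).2 u huv (by simpa using hadj)
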